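/- Let G be a finite simple graph. The function γ ↦ f_f(G,γ) is concave on the fractional perfect matching polytope P_f(G): for all fractional perfect matchings γ₁, γ₂ of G and every λ ∈ (0,1), f_f(G, λγ₁ + (1−λ)γ₂) ≥ λ f_f(G,γ₁) + (1−λ) f_f(G,γ₂). -/

import Mathlib

open Finset

variable {V : Type} [Fintype V] [DecidableEq V]

/-- The sum of `γ` over the edges of `G` incident with the vertex `v`.
(Functions on `E(G)` are encoded as functions on `Sym2 V` vanishing off the edge set.) -/
def vertexSum (G : SimpleGraph V) [DecidableRel G.Adj] (γ : Sym2 V → ℝ) (v : V) : ℝ :=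
  ∑ e ∈ G.edgeFinset, if v ∈ e then γ e else 0

/-- `γ` is a fractional perfect matching of `G`. -/
def IsFPM (G : SimpleGraph V) [DecidableRel G.Adj] (γ : Sym2 V → ℝ) : Prop :=
  (∀ e, 0 ≤ γ e) ∧ (∀ e ∉ G.edgeSet, γ e = 0) ∧ ∀ v, vertexSum G γ v = 1

/-- `α ↑ γ` : `α` is a (nonnegative) forcing function for the fractional perfect matching
`γ`, i.e. `α ⪯ γ` and `γ` is the unique fractional perfect matching `γ'` with `α ⪯ γ'`. -/
def IsForcing (G : SimpleGraph V) [DecidableRel G.Adj] (α γ : Sym2 V → ℝ) : Prop :=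
  (∀ e, 0 ≤ α e) ∧ (∀ e ∉ G.edgeSet, α e = 0) ∧ α ≤ γ ∧
    ∀ γ', IsFPM G γ' → α ≤ γ' → γ' = γ

/-- `|α|`, the sum of the values of `α` over all edges of `G`. -/
def eSum (G : SimpleGraph V) [DecidableRel G.Adj] (α : Sym2 V → ℝ) : ℝ :=
  ∑ e ∈ G.edgeFinset, α e

/-- The fractional forcing number `f_f(G,γ) = min {|α| : α ↑ γ}`. -/
noncomputable def ffN (G : SimpleGraph V) [DecidableRel G.Adj] (γ : Sym2 V → ℝ) : ℝ :=
  sInf {x : ℝ | ∃ α, IsForcing G α γ ∧ x = eSum G α}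

theorem vertexSum_add_smul (G : SimpleGraph V) [DecidableRel G.Adj] (a b : ℝ)
    (γ δ : Sym2 V → ℝ) (v : V) :
    vertexSum G (fun e => a * γ e + b * δ e) v = a * vertexSum G γ v + b * vertexSum G δ v := by
  simp only [vertexSum, Finset.mul_sum, ← Finset.sum_add_distrib]
  refine Finset.sum_congr rfl fun e _ => ?_
  split_ifs <;> ring

theorem IsFPM.convex_comb {G : SimpleGraph V} [DecidableRel G.Adj] {γ₁ γ₂ : Sym2 V → ℝ}
    (h₁ : IsFPM G γ₁) (h₂ : IsFPM G γ₂) {l : ℝ} (hl0 : 0 ≤ l) (hl1 : l ≤ 1) :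
    IsFPM G (fun e => l * γ₁ e + (1 - l) * γ₂ e) := by
  refine ⟨fun e => ?_, fun e he => ?_, fun v => ?_⟩
  · have := h₁.1 e
    have := h₂.1 e
    have : 0 ≤ 1 - l := by linarith
    positivity
  · simp [h₁.2.1 e he, h₂.2.1 e he]
  · rw [vertexSum_add_smul, h₁.2.2, h₂.2.2]
    ring

/-- A fractional perfect matching is a forcing function for itself. -/
theorem IsFPM.isForcing_self {G : SimpleGraph V} [DecidableRel G.Adj] {γ : Sym2 V → ℝ}
    (h : IsFPM G γ) : IsForcing G γ γ := by
  refine ⟨h.1, h.2.1, le_rfl, fun γ' h' hle => funext fun e => ?_⟩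
  by_cases he : e ∈ G.edgeSet
  · obtain ⟨v, hv⟩ : ∃ v, v ∈ e := ⟨_, e.out_fst_mem⟩
    have hsum : vertexSum G γ v = vertexSum G γ' v := by rw [h.2.2, h'.2.2]
    have hterm : ∀ f ∈ G.edgeFinset,
        (if v ∈ f then γ f else 0) ≤ if v ∈ f then γ' f else 0 := by
      intro f _
      split_ifs
      exacts [hle f, le_rfl]
    have := (Finset.sum_eq_sum_iff_of_le hterm).1 hsum e (SimpleGraph.mem_edgeFinset.2 he)
    simpa [hv] using this.symm
  · rw [h.2.1 e he, h'.2.1 e he]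

/-- A direction in the kernel of all vertex sums which is nonnegative wherever a forcing function
`α` of `γ` agrees with `γ` vanishes. -/
theorem IsForcing.direction_eq_zero {G : SimpleGraph V} [DecidableRel G.Adj]
    {α γ d : Sym2 V → ℝ} (hα : IsForcing G α γ) (hγ : IsFPM G γ)
    (hd : ∀ e ∉ G.edgeSet, d e = 0) (hsum : ∀ v, vertexSum G d v = 0)
    (hnonneg : ∀ e, α e = γ e → 0 ≤ d e) : d = 0 := by
  obtain ⟨hα0, -, hle, huniq⟩ := hα
  have hev : ∀ᶠ t in nhdsWithin (0 : ℝ) (Set.Ioi 0), ∀ e, α e ≤ γ e + t * d e := by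
    refine Filter.eventually_all.2 fun e => ?_
    rcases (hle e).eq_or_lt with heq | hlt
    · filter_upwards [self_mem_nhdsWithin] with t (ht : 0 < t)
      have := mul_nonneg ht.le (hnonneg e heq)
      linarith
    · have hc : Filter.Tendsto (fun t : ℝ => γ e + t * d e) (nhds 0) (nhds (γ e)) := by
        have : Continuous fun t : ℝ => γ e + t * d e := by fun_prop
        simpa using this.tendsto 0
      filter_upwards [nhdsWithin_le_nhds (hc.eventually (lt_mem_nhds hlt))] with t ht
      exact ht.le
  obtain ⟨t, ht, ht0⟩ := (hev.and self_mem_nhdsWithin).exists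
  have hfpm : IsFPM G (fun e => 1 * γ e + t * d e) := by
    refine ⟨fun e => ?_, fun e he => ?_, fun v => ?_⟩
    · simpa using (hα0 e).trans (ht e)
    · simp [hγ.2.1 e he, hd e he]
    · rw [vertexSum_add_smul, hγ.2.2, hsum]
      ring
  have heq := huniq _ hfpm fun e => by simpa using ht e
  funext e
  have := congrFun heq e
  have ht0' : t ≠ 0 := ne_of_gt ht0
  simpa [ht0'] using this

/-- The edges on which a forcing function of `γ` is tight force every fractional perfect
matching. -/
theorem IsForcing.isForcing_indicator {G : SimpleGraph V} [DecidableRel G.Adj]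
    {α γ δ : Sym2 V → ℝ} (hα : IsForcing G α γ) (hγ : IsFPM G γ) (hδ : IsFPM G δ) :
    IsForcing G ({e | α e = γ e}.indicator δ) δ := by
  refine ⟨fun e => Set.indicator_nonneg (fun e _ => hδ.1 e) e, fun e he => ?_,
    Set.indicator_le_self' fun e _ => hδ.1 e, fun δ' hδ' hle => ?_⟩
  · simp [Set.indicator_apply, hδ.2.1 e he]
  · have hzero : (fun e => 1 * δ' e + (-1) * δ e) = 0 := by
      refine hα.direction_eq_zero hγ (fun e he => ?_) (fun v => ?_) fun e he => ?_
      · simp [hδ.2.1 e he, hδ'.2.1 e he]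
      · rw [vertexSum_add_smul, hδ.2.2, hδ'.2.2]
        ring
      · have := hle e
        rw [Set.indicator_of_mem (show e ∈ {e | α e = γ e} from he)] at this
        linarith
    funext e
    have := congrFun hzero e
    simp only [Pi.zero_apply] at this
    linarith

theorem ffN_le_eSum {G : SimpleGraph V} [DecidableRel G.Adj] {α γ : Sym2 V → ℝ}
    (hα : IsForcing G α γ) : ffN G γ ≤ eSum G α := by
  refine csInf_le ⟨0, ?_⟩ ⟨α, hα, rfl⟩
  rintro x ⟨β, hβ, rfl⟩
  exact Finset.sum_nonneg fun e _ => hβ.1 e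

/-- `γ ↦ f_f(G,γ)` is concave on the fractional perfect matching polytope. -/
theorem ffN_concave (G : SimpleGraph V) [DecidableRel G.Adj]
    (γ₁ γ₂ : Sym2 V → ℝ) (hγ₁ : IsFPM G γ₁) (hγ₂ : IsFPM G γ₂)
    (l : ℝ) (hl0 : 0 < l) (hl1 : l < 1) :
    l * ffN G γ₁ + (1 - l) * ffN G γ₂ ≤
      ffN G (fun e => l * γ₁ e + (1 - l) * γ₂ e) := by
  have hγ := hγ₁.convex_comb hγ₂ hl0.le hl1.le
  refine le_csInf ⟨_, _, hγ.isForcing_self, rfl⟩ ?_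
  rintro x ⟨α, hα, rfl⟩
  have h₁ := ffN_le_eSum (hα.isForcing_indicator hγ hγ₁)
  have h₂ := ffN_le_eSum (hα.isForcing_indicator hγ hγ₂)
  refine (add_le_add (mul_le_mul_of_nonneg_left h₁ hl0.le)
    (mul_le_mul_of_nonneg_left h₂ (sub_nonneg.2 hl1.le))).trans ?_
  simp only [eSum, Finset.mul_sum, ← Finset.sum_add_distrib]
  refine Finset.sum_le_sum fun e _ => ?_
  by_cases he : α e = l * γ₁ e + (1 - l) * γ₂ e
  · simp [he]
  · simpa [Set.indicator_apply, he] using hα.1 e
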